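/- Let k, ε, T, ω be real numbers with k > 0. Then λ = iω satisfies the characteristic equation (−λ + 1/2 − (k/2)e^{−λεT} sin T)² + (k²/4)e^{−2λεT} cos² T = 0 if and only if either [sin((1−εω)T) = 1/k and cos((1−εω)T) = 2ω/k] or [sin((1+εω)T) = 1/k and cos((1+εω)T) = −2ω/k]. -/

import Mathlib

/-- A complex number of the form `(1/2 - (k/2) s) + i (-ω + (k/2) c)` vanishes iff `s = 1/k` and
`c = 2ω/k`. -/
lemma linear_factor_eq_zero_iff {k : ℝ} (hk : k ≠ 0) (ω s c : ℝ) :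
    ((1 / 2 - k / 2 * s : ℝ) : ℂ) + ((-ω + k / 2 * c : ℝ) : ℂ) * Complex.I = 0 ↔
      s = 1 / k ∧ c = 2 * ω / k := by
  rw [← Complex.mk_eq_add_mul_I, Complex.ext_iff, eq_div_iff hk, eq_div_iff hk]
  simp only [Complex.zero_re, Complex.zero_im]
  constructor <;> rintro ⟨h₁, h₂⟩ <;> constructor <;> linarith

lemma exp_neg_I_mul_ofReal (θ : ℝ) :
    Complex.exp (-(θ * Complex.I)) = Real.cos θ - Real.sin θ * Complex.I := by
  rw [← neg_mul, Complex.exp_mul_I, Complex.cos_neg, Complex.sin_neg, Complex.ofReal_cos,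
    Complex.ofReal_sin]
  ring


/-- For the delayed van der Pol slow flow (approach II) with `k > 0`, `λ = iω`
is a root of the characteristic equation iff one of two real trigonometric
systems holds; this follows from factoring the characteristic equation. -/
theorem stmt_14 (k ε T ω : ℝ) (hk : k > 0) :
    ((-(Complex.I * (ω : ℂ)) + 1/2
        - (k : ℂ)/2 * Complex.exp (-(Complex.I * (ω : ℂ)) * (ε : ℂ) * (T : ℂ)) * (Real.sin T : ℂ))^2
      + (k : ℂ)^2/4 * Complex.exp (-2 * (Complex.I * (ω : ℂ)) * (ε : ℂ) * (T : ℂ)) * (Real.cos T : ℂ)^2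
        = 0) ↔
    ((Real.sin ((1 - ε*ω) * T) = 1/k ∧ Real.cos ((1 - ε*ω) * T) = 2*ω/k) ∨
     (Real.sin ((1 + ε*ω) * T) = 1/k ∧ Real.cos ((1 + ε*ω) * T) = -2*ω/k)) := by
  rw [← linear_factor_eq_zero_iff hk.ne', show -2 * ω / k = 2 * (-ω) / k by ring]
  have hconj : (Real.sin ((1 + ε*ω) * T) = 1/k ∧ Real.cos ((1 + ε*ω) * T) = 2 * (-ω) / k) ↔
      ((1 / 2 - k / 2 * Real.sin ((1 + ε*ω) * T) : ℝ) : ℂ) +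
        ((-ω + k / 2 * -Real.cos ((1 + ε*ω) * T) : ℝ) : ℂ) * Complex.I = 0 := by
    rw [linear_factor_eq_zero_iff hk.ne', mul_neg, neg_div, neg_eq_iff_eq_neg]
  rw [hconj, ← mul_eq_zero]
  have hE : Complex.exp (-(Complex.I * (ω : ℂ)) * (ε : ℂ) * (T : ℂ)) =
      Real.cos (ε * ω * T) - Real.sin (ε * ω * T) * Complex.I := by
    rw [← exp_neg_I_mul_ofReal]
    congr 1
    push_cast
    ring
  have hE2 : Complex.exp (-2 * (Complex.I * (ω : ℂ)) * (ε : ℂ) * (T : ℂ)) =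
      (Real.cos (ε * ω * T) - Real.sin (ε * ω * T) * Complex.I) ^ 2 := by
    rw [← hE, ← Complex.exp_nat_mul]
    congr 1
    push_cast
    ring
  rw [hE, hE2, show (1 - ε * ω) * T = T - ε * ω * T by ring,
    show (1 + ε * ω) * T = T + ε * ω * T by ring, Real.sin_sub, Real.cos_sub, Real.sin_add,
    Real.cos_add]
  generalize Real.cos (ε * ω * T) = a
  generalize Real.sin (ε * ω * T) = b
  generalize Real.cos T = c
  generalize Real.sin T = s
  have factor : ∀ A B : ℂ, A ^ 2 + B ^ 2 = (A + B * Complex.I) * (A - B * Complex.I) := by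
    intro A B
    linear_combination B ^ 2 * Complex.I_sq
  rw [show (k : ℂ) ^ 2 / 4 * (a - b * Complex.I) ^ 2 * (c : ℂ) ^ 2 =
    (k / 2 * (a - b * Complex.I) * c) ^ 2 by ring, factor]
  congr! 2
  · push_cast
    linear_combination -(k / 2 * b * c : ℂ) * Complex.I_sq
  · push_cast
    linear_combination (k / 2 * b * c : ℂ) * Complex.I_sq
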